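/- Let d ≥ 3, and let v : ℝ^d → ℝ be nonnegative, bounded, measurable, with bounded support, and not almost everywhere zero. Set Y_x = ∫₀^∞ v(W_x(s)) ds. Then there exists α₁ ∈ (0, ∞) such that E[e^{α Y_x}] < ∞ for all α < α₁ and all x ∈ ℝ^d, while E[e^{α Y_x}] = ∞ for all α > α₁ and all x ∈ ℝ^d. -/

import Mathlib

open MeasureTheory Real Filter Topology ProbabilityTheory

noncomputable section

/-- Euclidean space `ℝ^d`. -/
abbrev Euc (d : ℕ) := EuclideanSpace ℝ (Fin d)

/-- The Brownian transition density `q(s; w) = (2πs)^{-d/2} exp(-|w|²/(2s))`. -/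
def heatKernel (d : ℕ) (s : ℝ) (w : Euc d) : ℝ :=
  (2 * π * s) ^ (-(d : ℝ) / 2) * Real.exp (-‖w‖ ^ 2 / (2 * s))

/-- Joint density of a Brownian motion started at `x`, at times `s 0 < s 1 < ⋯`. -/
def jointDensity (d : ℕ) {k : ℕ} (x : Euc d) (s : Fin k → ℝ) (z : Fin k → Euc d) : ℝ :=
  ∏ j : Fin k,
    heatKernel d (s j - if (j : ℕ) = 0 then 0 else s ⟨(j : ℕ) - 1, lt_of_le_of_lt (Nat.sub_le _ _) j.isLt⟩)
      (z j - if (j : ℕ) = 0 then x else z ⟨(j : ℕ) - 1, lt_of_le_of_lt (Nat.sub_le _ _) j.isLt⟩)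

/-- Joint density of the Brownian bridge from `a` to `b` in time `t`, at interior times `s`. -/
def bridgeDensity (d : ℕ) {k : ℕ} (t : ℝ) (a b : Euc d) (s : Fin k → ℝ) (z : Fin k → Euc d) : ℝ :=
  jointDensity d a (Fin.snoc s t) (Fin.snoc z b) / heatKernel d t (b - a)

/-- The open ordered simplex `0 < s₁ < ⋯ < s_k < t`. -/
def simplex (k : ℕ) (t : ℝ) : Set (Fin k → ℝ) :=
  {s | StrictMono s ∧ ∀ i, 0 < s i ∧ s i < t}

/-- `W` is a standard `d`-dimensional Brownian motion started at `x`, characterized by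
continuous paths and finite-dimensional densities given by products of heat kernels. -/
def IsBrownianMotion {Ω : Type*} [MeasureSpace Ω] {d : ℕ} (x : Euc d)
    (W : ℝ → Ω → Euc d) : Prop :=
  (∀ ω, W 0 ω = x) ∧ (∀ ω, Continuous fun s => W s ω) ∧
  ∀ (k : ℕ) (s : Fin (k + 1) → ℝ), StrictMono s → (∀ i, 0 < s i) →
    Measure.map (fun ω (i : Fin (k + 1)) => W (s i) ω) (ℙ : Measure Ω) =
      (volume : Measure (Fin (k + 1) → Euc d)).withDensity
        (fun z => ENNReal.ofReal (jointDensity d x s z))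

/-- `X` is a `d`-dimensional Brownian bridge from `a` to `b` in time `t`. -/
def IsBrownianBridge {Ω : Type*} [MeasureSpace Ω] {d : ℕ} (t : ℝ) (a b : Euc d)
    (X : ℝ → Ω → Euc d) : Prop :=
  (∀ ω, X 0 ω = a) ∧ (∀ ω, X t ω = b) ∧
  (∀ ω, ContinuousOn (fun s => X s ω) (Set.Icc 0 t)) ∧
  ∀ (k : ℕ) (s : Fin (k + 1) → ℝ), StrictMono s → (∀ i, 0 < s i ∧ s i < t) →
    Measure.map (fun ω (i : Fin (k + 1)) => X (s i) ω) (ℙ : Measure Ω) =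
      (volume : Measure (Fin (k + 1) → Euc d)).withDensity
        (fun z => ENNReal.ofReal (bridgeDensity d t a b s z))

/-- The path integral `∫₀^t v(X_s) ds`. -/
def pathInt {Ω : Type*} {d : ℕ} (v : Euc d → ℝ) (X : ℝ → Ω → Euc d) (t : ℝ) (ω : Ω) : ℝ :=
  ∫ s in Set.Ioc (0 : ℝ) t, v (X s ω)

/-- The total path integral `∫₀^∞ v(X_s) ds`. -/
def pathIntInf {Ω : Type*} {d : ℕ} (v : Euc d → ℝ) (X : ℝ → Ω → Euc d) (ω : Ω) : ℝ :=
  ∫ s in Set.Ioi (0 : ℝ), v (X s ω)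

/-- The density ratio `Q_{j} = q(t; y - x)/q(Δ_j s; Δ_j z)` with the conventions
`s₀ = 0`, `s_{k+1} = t`, `z₀ = x`, `z_{k+1} = y`. -/
def Qratio (d : ℕ) {k : ℕ} (t : ℝ) (x y : Euc d) (s : Fin k → ℝ) (z : Fin k → Euc d)
    (j : Fin (k + 1)) : ℝ :=
  heatKernel d t (y - x) /
    heatKernel d
      ((Fin.cons 0 (Fin.snoc s t) : Fin (k + 2) → ℝ) j.succ -
        (Fin.cons 0 (Fin.snoc s t) : Fin (k + 2) → ℝ) j.castSucc)
      ((Fin.cons x (Fin.snoc z y) : Fin (k + 2) → Euc d) j.succ -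
        (Fin.cons x (Fin.snoc z y) : Fin (k + 2) → Euc d) j.castSucc)

/-! ### Lebesgue integrals over finite powers -/

/-- Integration over `Fin (n + 1) → α` as an iterated integral. -/
lemma lintegral_fin_succ {α : Type*} [MeasureSpace α] [SigmaFinite (volume : Measure α)] {n : ℕ}
    {f : (Fin (n + 1) → α) → ENNReal} (hf : Measurable f) :
    ∫⁻ s, f s = ∫⁻ a : α, ∫⁻ t : Fin n → α, f (Fin.cons a t) := by
  have h := (volume_preserving_piFinSuccAbove (fun _ : Fin (n + 1) => α) 0).symm
  rw [← h.lintegral_comp hf]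
  have h2 : Measurable fun p : α × (Fin n → α) =>
      f ((MeasurableEquiv.piFinSuccAbove (fun _ : Fin (n + 1) => α) 0).symm p) :=
    hf.comp (MeasurableEquiv.measurable _)
  refine (lintegral_prod _ h2.aemeasurable).trans ?_
  simp only [MeasurableEquiv.piFinSuccAbove_symm_apply, Fin.insertNthEquiv_zero]
  rfl

/-- Fubini for the power of an integral. -/
lemma lintegral_prod_eq_pow {α : Type*} [MeasureSpace α] [SigmaFinite (volume : Measure α)]
    {f : α → ENNReal} (hf : Measurable f) (n : ℕ) :
    ∫⁻ s : Fin n → α, ∏ i, f (s i) = (∫⁻ a, f a) ^ n := by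
  induction n with
  | zero => simp [volume_pi]
  | succ n ih =>
    rw [lintegral_fin_succ (by fun_prop)]
    simp only [Fin.prod_univ_succ, Fin.cons_zero, Fin.cons_succ]
    rw [pow_succ', ← ih, ← lintegral_mul_const _ hf]
    refine lintegral_congr fun a => ?_
    rw [lintegral_const_mul _ (by fun_prop)]

lemma ae_injective_fin (n : ℕ) : ∀ᵐ s : Fin n → ℝ, Function.Injective s := by
  have h : ∀ i j : Fin n, i ≠ j → ∀ᵐ s : Fin n → ℝ, s i ≠ s j := by
    intro i j hij
    let p : Submodule ℝ (Fin n → ℝ) :=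
      LinearMap.ker (LinearMap.proj (R := ℝ) (φ := fun _ : Fin n => ℝ) i - LinearMap.proj j)
    have hp : p ≠ ⊤ := by
      intro h
      have : (Pi.single i (1 : ℝ) : Fin n → ℝ) ∈ p := by rw [h]; trivial
      simp [p, hij] at this
    have := Measure.addHaar_submodule (volume : Measure (Fin n → ℝ)) p hp
    rw [ae_iff]
    convert this using 2
    ext s
    simp [p, sub_eq_zero]
  have h' : ∀ᵐ s : Fin n → ℝ, ∀ i j : Fin n, i ≠ j → s i ≠ s j := by
    rw [ae_all_iff]; intro i; rw [ae_all_iff]; intro j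
    by_cases hij : i = j
    · simp [hij]
    · filter_upwards [h i j hij] with s hs _ using hs
  filter_upwards [h'] with s hs i j hij
  by_contra hne
  exact hs i j hne hij

lemma measurableSet_strictMono_fin (n : ℕ) : MeasurableSet {s : Fin n → ℝ | StrictMono s} := by
  have : {s : Fin n → ℝ | StrictMono s} = ⋂ i, ⋂ j, ⋂ _ : i < j, {s | s i < s j} := by
    ext s; simp [StrictMono]
  rw [this]
  refine .iInter fun i => .iInter fun j => .iInter fun _ => ?_
  exact measurableSet_lt (measurable_pi_apply i) (measurable_pi_apply j)

/-- The integral of a symmetric function over the cube is `n!` times the integral over the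
increasing chamber. -/
lemma lintegral_eq_factorial_mul_strictMono {n : ℕ} {f : (Fin n → ℝ) → ENNReal}
    (hsymm : ∀ (σ : Equiv.Perm (Fin n)) s, f (s ∘ σ) = f s) :
    ∫⁻ s, f s = (n.factorial : ENNReal) * ∫⁻ s in {s : Fin n → ℝ | StrictMono s}, f s := by
  let A : Equiv.Perm (Fin n) → Set (Fin n → ℝ) := fun σ => {s | StrictMono (s ∘ σ)}
  have hmp : ∀ σ : Equiv.Perm (Fin n),
      MeasurePreserving (MeasurableEquiv.piCongrLeft (fun _ : Fin n => ℝ) σ.symm) :=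
    fun σ => volume_measurePreserving_piCongrLeft (fun _ : Fin n => ℝ) σ.symm
  have hcoe : ∀ (σ : Equiv.Perm (Fin n)) (s : Fin n → ℝ),
      MeasurableEquiv.piCongrLeft (fun _ : Fin n => ℝ) σ.symm s = s ∘ σ := by
    intro σ s
    ext i
    have := MeasurableEquiv.piCongrLeft_apply_apply (β := fun _ : Fin n => ℝ) σ.symm s (σ i)
    simpa using this
  have hA : ∀ σ, A σ = MeasurableEquiv.piCongrLeft (fun _ : Fin n => ℝ) σ.symm ⁻¹'
      {s | StrictMono s} := by
    intro σ; ext s; simp only [A, Set.mem_ofPred_eq, Set.mem_preimage, hcoe]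
  have hAm : ∀ σ, MeasurableSet (A σ) := fun σ => by
    rw [hA]; exact (MeasurableEquiv.measurable _) (measurableSet_strictMono_fin n)
  have hint : ∀ σ, ∫⁻ s in A σ, f s = ∫⁻ s in {s : Fin n → ℝ | StrictMono s}, f s := by
    intro σ
    have h := (hmp σ).setLIntegral_comp_preimage_emb (MeasurableEquiv.measurableEmbedding _) f
      {s | StrictMono s}
    rw [← hA] at h
    simpa only [hcoe, hsymm] using h
  have hdisj : Set.PairwiseDisjoint (↑(Finset.univ : Finset (Equiv.Perm (Fin n)))) A := by
    intro σ _ τ _ hne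
    refine Set.disjoint_left.mpr fun s hs ht => hne ?_
    have hs' : StrictMono (s ∘ σ) := hs
    have ht' : StrictMono (s ∘ τ) := ht
    have hinj : Function.Injective s := by
      have := hs'.injective.comp σ.symm.injective
      simpa [Function.comp_assoc] using this
    have h1 := Tuple.unique_monotone hs'.monotone ht'.monotone
    ext i
    have := congrFun h1 i
    exact congrArg _ (hinj this)
  have hcover : (⋃ σ ∈ (Finset.univ : Finset (Equiv.Perm (Fin n))), A σ) =ᵐ[volume]
      (Set.univ : Set (Fin n → ℝ)) := by
    rw [eventuallyEq_univ]
    filter_upwards [ae_injective_fin n] with s hs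
    simp only [Set.mem_iUnion]
    exact ⟨Tuple.sort s, Finset.mem_univ _,
      (Tuple.monotone_sort s).strictMono_of_injective (hs.comp (Tuple.sort s).injective)⟩
  rw [← setLIntegral_univ, ← setLIntegral_congr hcover,
    lintegral_biUnion_finset hdisj (fun σ _ => hAm σ)]
  simp [hint, Fintype.card_perm]

/-! ### The heat kernel and the Green function -/

lemma heatKernel_pos {d : ℕ} {s : ℝ} (hs : 0 < s) (w : Euc d) : 0 < heatKernel d s w := by
  unfold heatKernel; positivity

lemma measurable_heatKernel (d : ℕ) :
    Measurable fun p : ℝ × Euc d => heatKernel d p.1 p.2 := by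
  unfold heatKernel; fun_prop

/-- The heat kernel as an extended nonnegative real. -/
def heatKernelE (d : ℕ) (s : ℝ) (w : Euc d) : ENNReal := ENNReal.ofReal (heatKernel d s w)

@[fun_prop]
lemma measurable_heatKernelE_comp {d : ℕ} {β : Type*} [MeasurableSpace β] {f : β → ℝ}
    {g : β → Euc d}
    (hf : Measurable f) (hg : Measurable g) : Measurable fun b => heatKernelE d (f b) (g b) :=
  ((measurable_heatKernel d).comp (hf.prodMk hg)).ennreal_ofReal

lemma lintegral_heatKernelE {d : ℕ} {s : ℝ} (hs : 0 < s) : ∫⁻ w, heatKernelE d s w = 1 := by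
  have hb : 0 < 1 / (2 * s) := by positivity
  have h := GaussianFourier.integral_rexp_neg_mul_sq_norm (V := Euc d) hb
  have hfun : (fun w : Euc d => heatKernel d s w) =
      fun w => (2 * π * s) ^ (-(d : ℝ) / 2) * Real.exp (-(1 / (2 * s)) * ‖w‖ ^ 2) := by
    ext w; unfold heatKernel; congr 2; ring
  have hpi : π / (1 / (2 * s)) = 2 * π * s := by field_simp
  have hint : ∫ w, heatKernel d s w = 1 := by
    rw [hfun, integral_const_mul, h, hpi, finrank_euclideanSpace_fin,
      ← Real.rpow_add (by positivity)]
    rw [show -(d : ℝ) / 2 + d / 2 = 0 by ring, Real.rpow_zero]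
  have hi : Integrable fun w : Euc d => heatKernel d s w := by
    by_contra hc
    rw [integral_undef hc] at hint
    exact zero_ne_one hint
  unfold heatKernelE
  rw [← ofReal_integral_eq_lintegral_ofReal hi (ae_of_all _ fun w => (heatKernel_pos hs w).le),
    hint, ENNReal.ofReal_one]

/-- The Green function of Brownian motion. -/
def green (d : ℕ) (x y : Euc d) : ENNReal := ∫⁻ s in Set.Ioi (0 : ℝ), heatKernelE d s (y - x)

@[fun_prop]
lemma measurable_green_comp {d : ℕ} {β : Type*} [MeasurableSpace β] {f g : β → Euc d}
    (hf : Measurable f) (hg : Measurable g) : Measurable fun b => green d (f b) (g b) := by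
  unfold green
  exact Measurable.lintegral_prod_right' (f := fun p : β × ℝ => heatKernelE d p.2 (g p.1 - f p.1))
    (by fun_prop)

/-- The part of the Green function from large times is bounded when `3 ≤ d`. -/
lemma exists_lintegral_Ioi_heatKernelE_le {d : ℕ} (hd : 3 ≤ d) {ε : ℝ} (hε : 0 < ε) :
    ∃ M : ENNReal, M ≠ ⊤ ∧ ∀ w : Euc d, ∫⁻ s in Set.Ioi ε, heatKernelE d s w ≤ M := by
  refine ⟨∫⁻ s in Set.Ioi ε,
    ENNReal.ofReal ((2 * π) ^ (-(d : ℝ) / 2) * s ^ (-(d : ℝ) / 2)), ?_, fun w => ?_⟩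
  · have hd' : (3 : ℝ) ≤ d := by exact_mod_cast hd
    have hi := (integrableOn_Ioi_rpow_of_lt (a := -(d : ℝ) / 2) (by linarith) hε).const_mul
      ((2 * π) ^ (-(d : ℝ) / 2))
    exact hi.lintegral_lt_top.ne
  · refine setLIntegral_mono (by fun_prop) fun s hs => ENNReal.ofReal_le_ofReal ?_
    have hs : ε < s := hs
    have hs0 : 0 < s := hε.trans hs
    rw [← Real.mul_rpow (by positivity) hs0.le]
    unfold heatKernel
    refine mul_le_of_le_one_right (by positivity) (Real.exp_le_one_iff.mpr ?_)
    rw [neg_div]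
    exact neg_nonpos.mpr (by positivity)

/-- The Green function is bounded below on bounded sets. -/
lemma exists_le_green (d : ℕ) (r : ℝ) :
    ∃ g : ENNReal, g ≠ 0 ∧ ∀ x y : Euc d, ‖x‖ ≤ r → ‖y‖ ≤ r → g ≤ green d x y := by
  refine ⟨ENNReal.ofReal ((4 * π) ^ (-(d : ℝ) / 2) * Real.exp (-(2 * r) ^ 2 / 2)), ?_,
    fun x y hx hy => ?_⟩
  · rw [Ne, ENNReal.ofReal_eq_zero, not_le]; positivity
  · have hsub : Set.Ioc (1 : ℝ) 2 ⊆ Set.Ioi 0 := fun s hs => lt_trans one_pos hs.1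
    refine le_trans ?_ (lintegral_mono_set hsub)
    have hconst : ∀ c : ENNReal, ∫⁻ _ in Set.Ioc (1 : ℝ) 2, c = c := by
      intro c; rw [setLIntegral_const, Real.volume_Ioc]; norm_num
    rw [← hconst (ENNReal.ofReal _)]
    refine setLIntegral_mono (by fun_prop) fun s hs => ENNReal.ofReal_le_ofReal ?_
    have hs1 : 1 < s := hs.1
    have hs2 : s ≤ 2 := hs.2
    have hn : ‖y - x‖ ≤ 2 * r := (norm_sub_le _ _).trans (by linarith)
    have hn2 : ‖y - x‖ ^ 2 ≤ (2 * r) ^ 2 := by gcongr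
    unfold heatKernel
    refine mul_le_mul ?_ (Real.exp_le_exp.mpr ?_) (by positivity) (by positivity)
    · refine Real.rpow_le_rpow_of_nonpos (by positivity) (by nlinarith [Real.pi_pos]) ?_
      rw [neg_div]
      exact neg_nonpos.mpr (by positivity)
    · rw [neg_div, neg_div, neg_le_neg_iff, div_le_div_iff₀ (by positivity) (by positivity)]
      nlinarith [sq_nonneg ‖y - x‖, sq_nonneg (2 * r)]

/-! ### Iterating the Green operator -/

/-- The iterates `(G V)ⁿ 1` of the Green operator with potential `V`. -/
def greenIter (d : ℕ) (V : Euc d → ENNReal) : ℕ → Euc d → ENNReal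
  | 0, _ => 1
  | n + 1, x => ∫⁻ y, green d x y * (V y * greenIter d V n y)

lemma measurable_greenIter {d : ℕ} {V : Euc d → ENNReal} (hV : Measurable V) (n : ℕ) :
    Measurable (greenIter d V n) := by
  induction n with
  | zero => exact measurable_const
  | succ n ih =>
    exact Measurable.lintegral_prod_right'
      (f := fun p : Euc d × Euc d => green d p.1 p.2 * (V p.2 * greenIter d V n p.2))
      (by fun_prop)

/-- Splitting the Green function at time `ε` bounds one iterate by the previous one. -/
lemma exists_greenIter_succ_le {d : ℕ} (hd : 3 ≤ d) {V : Euc d → ENNReal} (hV : Measurable V)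
    {C : ENNReal} (hC : ∀ z, V z ≤ C) {ε : ℝ} (hε : 0 < ε) :
    ∃ M : ENNReal, M ≠ ⊤ ∧ ∀ n x, greenIter d V (n + 1) x ≤
      M * (∫⁻ y, V y * greenIter d V n y) +
        ENNReal.ofReal ε * (C * ⨆ z, greenIter d V n z) := by
  obtain ⟨M, hM, hMle⟩ := exists_lintegral_Ioi_heatKernelE_le hd hε
  refine ⟨M, hM, fun n x => ?_⟩
  have hu := measurable_greenIter hV n
  have hsplit : ∀ y, green d x y = (∫⁻ s in Set.Ioi ε, heatKernelE d s (y - x)) +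
      ∫⁻ s in Set.Ioc 0 ε, heatKernelE d s (y - x) := by
    intro y
    unfold green
    rw [add_comm, ← lintegral_union measurableSet_Ioi (by
      rw [Set.disjoint_left]; intro s hs hs'; exact not_lt.mpr hs.2 hs'),
      Set.Ioc_union_Ioi_eq_Ioi hε.le]
  have hnear : ∫⁻ y, ∫⁻ s in Set.Ioc 0 ε, heatKernelE d s (y - x) = ENNReal.ofReal ε := by
    rw [lintegral_lintegral_swap (by fun_prop)]
    rw [setLIntegral_congr_fun (g := fun _ => 1) measurableSet_Ioc]
    · simp
    · intro s hs
      exact (lintegral_sub_right_eq_self (fun w => heatKernelE d s w) x).trans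
        (lintegral_heatKernelE hs.1)
  calc greenIter d V (n + 1) x
      ≤ ∫⁻ y, (M * (V y * greenIter d V n y) +
          (∫⁻ s in Set.Ioc 0 ε, heatKernelE d s (y - x)) * (C * ⨆ z, greenIter d V n z)) := by
        refine lintegral_mono fun y => ?_
        dsimp only
        rw [hsplit, add_mul]
        gcongr
        · exact hMle _
        · exact hC _
        · exact le_iSup (greenIter d V n) y
    _ = _ := by
        rw [lintegral_add_left (by fun_prop), lintegral_const_mul _ (by fun_prop),
          lintegral_mul_const, hnear]
        exact Measurable.lintegral_prod_right'
          (f := fun p : Euc d × ℝ => heatKernelE d p.2 (p.1 - x)) (by fun_prop)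

lemma exists_greenIter_le_pow {d : ℕ} (hd : 3 ≤ d) {V : Euc d → ENNReal} (hV : Measurable V)
    {C : ENNReal} (hC : ∀ z, V z ≤ C) (hC' : C ≠ ⊤) (hVi : ∫⁻ y, V y ≠ ⊤) :
    ∃ K : ENNReal, K ≠ ⊤ ∧ ∀ n x, greenIter d V n x ≤ K ^ n := by
  obtain ⟨M, hM, hle⟩ := exists_greenIter_succ_le hd hV hC one_pos
  refine ⟨M * (∫⁻ y, V y) + C, by finiteness, fun n => ?_⟩
  induction n with
  | zero => intro x; simp [greenIter]
  | succ n ih =>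
    intro x
    refine (hle n x).trans ?_
    rw [pow_succ', add_mul, mul_assoc, ENNReal.ofReal_one, one_mul, ← lintegral_mul_const _ hV]
    gcongr with y
    · exact ih y
    · exact iSup_le ih

/-- Iterates grow at least geometrically on a ball containing the support of `V`. -/
lemma exists_pow_le_greenIter {d : ℕ} {V : Euc d → ENNReal} (hV : Measurable V) {R : ℝ}
    (hR : ∀ z, V z ≠ 0 → ‖z‖ ≤ R) (hV0 : ∫⁻ y, V y ≠ 0) :
    ∃ c : ENNReal, c ≠ 0 ∧ ∀ n x, ‖x‖ ≤ R → c ^ n ≤ greenIter d V n x := by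
  obtain ⟨g, hg0, hg⟩ := exists_le_green d R
  refine ⟨g * ∫⁻ y, V y, mul_ne_zero hg0 hV0, fun n => ?_⟩
  induction n with
  | zero => intro x _; simp [greenIter]
  | succ n ih =>
    intro x hx
    calc (g * ∫⁻ y, V y) ^ (n + 1)
        = ∫⁻ y, g * (V y * (g * ∫⁻ y, V y) ^ n) := by
          rw [lintegral_const_mul _ (by fun_prop), lintegral_mul_const _ hV, pow_succ']; ring
      _ ≤ _ := by
          refine lintegral_mono fun y => ?_
          dsimp only
          by_cases hy : V y = 0
          · simp [hy]
          · have := hR y hy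
            gcongr
            · exact hg x y hx this
            · exact ih y this

/-- If the Green series converges at one point then it converges everywhere. -/
lemma tsum_greenIter_ne_top {d : ℕ} (hd : 3 ≤ d) {V : Euc d → ENNReal} (hV : Measurable V)
    {C : ENNReal} (hC : ∀ z, V z ≤ C) (hC' : C ≠ ⊤) {R : ℝ} (hR : ∀ z, V z ≠ 0 → ‖z‖ ≤ R)
    {b : ENNReal} (hb : b ≠ ⊤) {x₀ : Euc d} (h : ∑' n, b ^ n * greenIter d V n x₀ ≠ ⊤)
    (x : Euc d) : ∑' n, b ^ n * greenIter d V n x ≠ ⊤ := by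
  obtain ⟨ε, hε, hε2⟩ : ∃ ε : ℝ, 0 < ε ∧ b * (ENNReal.ofReal ε * C) ≤ 2⁻¹ := by
    have hbC : b * C ≠ ⊤ := by finiteness
    refine ⟨1 / (2 * ((b * C).toReal + 1)), by positivity, ?_⟩
    have h0 : 0 ≤ (b * C).toReal := ENNReal.toReal_nonneg
    rw [mul_left_comm, ← ENNReal.ofReal_toReal hbC, ← ENNReal.ofReal_mul (by positivity),
      show (2⁻¹ : ENNReal) = ENNReal.ofReal 2⁻¹ by simp]
    refine ENNReal.ofReal_le_ofReal ?_
    rw [ENNReal.toReal_ofReal h0, one_div, inv_mul_le_iff₀ (by positivity)]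
    linarith
  obtain ⟨M, hM, hle⟩ := exists_greenIter_succ_le hd hV hC hε
  obtain ⟨g, hg0, hg⟩ := exists_le_green d (max ‖x₀‖ R)
  let a : ℕ → ENNReal := fun n => ∫⁻ y, V y * greenIter d V n y
  have ha : ∀ n, g * a n ≤ greenIter d V (n + 1) x₀ := by
    intro n
    have hu := measurable_greenIter hV n
    rw [← lintegral_const_mul _ (by fun_prop)]
    refine lintegral_mono fun y => ?_
    dsimp only
    by_cases hy : V y = 0
    · simp [hy]
    · gcongr
      exact hg x₀ y (le_max_left _ _) ((hR y hy).trans (le_max_right _ _))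
  have hasum : ∑' n, b ^ (n + 1) * a n ≠ ⊤ := by
    have h1 : g * ∑' n, b ^ (n + 1) * a n ≤ ∑' n, b ^ n * greenIter d V n x₀ := by
      rw [← ENNReal.tsum_mul_left]
      refine le_trans (ENNReal.tsum_le_tsum fun n => ?_)
        (ENNReal.tsum_comp_le_tsum_of_injective (add_left_injective 1) _)
      rw [mul_left_comm]
      exact mul_le_mul_right (ha n) _
    intro htop
    rw [htop, ENNReal.mul_top hg0] at h1
    exact h (top_le_iff.mp h1)
  set D : ENNReal := 1 + M * ∑' n, b ^ (n + 1) * a n with hD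
  have hD' : D ≠ ⊤ := by finiteness
  have hS : ∀ N, ∑ n ∈ Finset.range N, b ^ n * ⨆ z, greenIter d V n z ≤ 2 * D := by
    intro N
    induction N with
    | zero => simp
    | succ N ih =>
      rw [Finset.sum_range_succ']
      calc _ ≤ (∑ n ∈ Finset.range N, (M * (b ^ (n + 1) * a n) +
              (b * (ENNReal.ofReal ε * C)) * (b ^ n * ⨆ z, greenIter d V n z))) + 1 := by
            refine add_le_add (Finset.sum_le_sum fun n _ => ?_) (by simp [greenIter])
            refine (mul_le_mul_right (iSup_le (hle n)) (b ^ (n + 1))).trans_eq ?_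
            ring
        _ ≤ M * (∑' n, b ^ (n + 1) * a n) + 2⁻¹ * (2 * D) + 1 := by
            rw [Finset.sum_add_distrib, ← Finset.mul_sum, ← Finset.mul_sum]
            gcongr
            exact ENNReal.sum_le_tsum _
        _ = 2 * D := by
            rw [← mul_assoc, ENNReal.inv_mul_cancel two_ne_zero ENNReal.ofNat_ne_top, one_mul,
              two_mul, hD]
            ring
  refine ne_top_of_le_ne_top (b := 2 * D) (by finiteness) ?_
  rw [ENNReal.tsum_eq_iSup_nat]
  refine iSup_le fun N => le_trans (Finset.sum_le_sum fun n _ => ?_) (hS N)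
  gcongr
  exact le_iSup (greenIter d V n) x

/-! ### Time-ordered integrals of the joint density -/

/-- The open chamber `0 < s₁ < ⋯ < sₙ`. -/
def timeChamber (n : ℕ) : Set (Fin n → ℝ) := {s | StrictMono s ∧ ∀ i, 0 < s i}

lemma measurableSet_timeChamber (n : ℕ) : MeasurableSet (timeChamber n) := by
  have : timeChamber n = {s | StrictMono s} ∩ ⋂ i, {s | 0 < s i} := by
    ext s; simp [timeChamber]
  rw [this]
  exact (measurableSet_strictMono_fin n).inter <| .iInter fun i =>
    measurableSet_lt measurable_const (measurable_pi_apply i)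

lemma cons_add_mem_timeChamber {n : ℕ} {a : ℝ} {s : Fin n → ℝ} :
    (Fin.cons a (s + fun _ => a) : Fin (n + 1) → ℝ) ∈ timeChamber (n + 1) ↔
      0 < a ∧ s ∈ timeChamber n := by
  constructor
  · rintro ⟨hm, hp⟩
    refine ⟨by simpa using hp 0, fun i j hij => ?_, fun i => ?_⟩
    · simpa using hm (Fin.succ_lt_succ_iff.mpr hij)
    · simpa using hm (Fin.succ_pos i)
  · rintro ⟨ha, hm, hp⟩
    refine ⟨fun i j => ?_, fun i => ?_⟩
    · refine Fin.cases ?_ (fun i => ?_) i <;> refine Fin.cases ?_ (fun j => ?_) j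
      · simp
      · intro _; simpa using hp j
      · simp
      · intro hij; simpa using hm (Fin.succ_lt_succ_iff.mp hij)
    · refine Fin.cases ?_ (fun i => ?_) i
      · simpa using ha
      · simpa using add_pos (hp i) ha

lemma jointDensity_pos {d n : ℕ} (x : Euc d) {s : Fin n → ℝ} (hs : s ∈ timeChamber n)
    (z : Fin n → Euc d) : 0 < jointDensity d x s z := by
  refine Finset.prod_pos fun j _ => heatKernel_pos ?_ _
  split_ifs with h
  · simpa using hs.2 j
  · exact sub_pos.mpr (hs.1 (Fin.lt_def.mpr (Nat.sub_lt (Nat.pos_of_ne_zero h) one_pos)))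

lemma jointDensity_cons {d n : ℕ} (x y : Euc d) (a : ℝ) (s : Fin n → ℝ) (z : Fin n → Euc d) :
    jointDensity d x (Fin.cons a (s + fun _ => a)) (Fin.cons y z) =
      heatKernel d a (y - x) * jointDensity d y s z := by
  unfold jointDensity
  rw [Fin.prod_univ_succ]
  congr 1
  · simp
  · refine Finset.prod_congr rfl fun j _ => ?_
    simp only [Fin.cons_succ, Fin.val_succ, Nat.add_sub_cancel, Nat.add_one_ne_zero, if_false]
    obtain ⟨j, hj⟩ := j
    cases j with
    | zero =>
      have : (⟨0, Nat.succ_pos n⟩ : Fin (n + 1)) = 0 := rfl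
      simp [this]
    | succ j =>
      have h1 : (Fin.cons a (s + fun _ => a) : Fin (n + 1) → ℝ) ⟨j + 1, by lia⟩ =
        s ⟨j, by lia⟩ + a := rfl
      have h2 : (Fin.cons y z : Fin (n + 1) → Euc d) ⟨j + 1, by lia⟩ = z ⟨j, by lia⟩ := rfl
      simp [h1, h2]

lemma measurable_jointDensity (d n : ℕ) :
    Measurable fun p : Euc d × (Fin n → ℝ) × (Fin n → Euc d) =>
      jointDensity d p.1 p.2.1 p.2.2 := by
  unfold jointDensity
  refine Finset.measurable_prod _ fun j _ => ?_
  have h := measurable_heatKernel d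
  refine h.comp (.prodMk ?_ ?_)
  · split_ifs <;> fun_prop
  · split_ifs <;> fun_prop

@[fun_prop]
lemma measurable_jointDensity_comp {d n : ℕ} {β : Type*} [MeasurableSpace β] {f : β → Euc d}
    {g : β → Fin n → ℝ} {h : β → Fin n → Euc d} (hf : Measurable f) (hg : Measurable g)
    (hh : Measurable h) : Measurable fun b => jointDensity d (f b) (g b) (h b) := by
  have h1 : Measurable fun b => (f b, g b, h b) := hf.prodMk (hg.prodMk hh)
  have h2 := (measurable_jointDensity d n).comp h1
  exact h2

/-- The expectation of `∏ V(W_{sᵢ})` for Brownian motion `W` started at `x`, in terms of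
densities. -/
def jointMoment (d : ℕ) (V : Euc d → ENNReal) {n : ℕ} (x : Euc d) (s : Fin n → ℝ) : ENNReal :=
  ∫⁻ z : Fin n → Euc d, ENNReal.ofReal (jointDensity d x s z) * ∏ i, V (z i)

lemma measurable_jointMoment {d : ℕ} {V : Euc d → ENNReal} (hV : Measurable V) {n : ℕ}
    {β : Type*} [MeasurableSpace β] {f : β → Euc d} {g : β → Fin n → ℝ} (hf : Measurable f)
    (hg : Measurable g) : Measurable fun b => jointMoment d V (f b) (g b) := by
  unfold jointMoment
  exact Measurable.lintegral_prod_right'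
    (f := fun p : β × (Fin n → Euc d) =>
      ENNReal.ofReal (jointDensity d (f p.1) (g p.1) p.2) * ∏ i, V (p.2 i)) (by fun_prop)

lemma jointMoment_cons {d : ℕ} {V : Euc d → ENNReal} (hV : Measurable V) {n : ℕ} (x : Euc d)
    {a : ℝ} (ha : 0 < a) (s : Fin n → ℝ) :
    jointMoment d V x (Fin.cons a (s + fun _ => a) : Fin (n + 1) → ℝ) =
      ∫⁻ y, heatKernelE d a (y - x) * (V y * jointMoment d V y s) := by
  unfold jointMoment
  rw [lintegral_fin_succ (by fun_prop)]
  refine lintegral_congr fun y => ?_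
  rw [← lintegral_const_mul _ (by fun_prop), ← lintegral_const_mul _ (by fun_prop)]
  refine lintegral_congr fun z => ?_
  rw [jointDensity_cons, ENNReal.ofReal_mul (heatKernel_pos ha _).le, Fin.prod_univ_succ]
  simp only [Fin.cons_zero, Fin.cons_succ, heatKernelE]
  ring

lemma setLIntegral_timeChamber_jointMoment {d : ℕ} {V : Euc d → ENNReal} (hV : Measurable V)
    (n : ℕ) (x : Euc d) :
    ∫⁻ s in timeChamber n, jointMoment d V x s = greenIter d V n x := by
  induction n generalizing x with
  | zero =>
    have : timeChamber 0 = Set.univ := by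
      ext s; simp [timeChamber, Subsingleton.strictMono]
    simp [this, jointMoment, jointDensity, greenIter, volume_pi]
  | succ n ih =>
    have hm : Measurable fun s : Fin (n + 1) → ℝ => jointMoment d V x s :=
      measurable_jointMoment hV measurable_const measurable_id
    have hm' : Measurable fun p : Euc d × (Fin n → ℝ) => jointMoment d V p.1 p.2 :=
      measurable_jointMoment hV measurable_fst measurable_snd
    have hu := measurable_greenIter hV n
    rw [← lintegral_indicator (measurableSet_timeChamber _),
      lintegral_fin_succ (hm.indicator (measurableSet_timeChamber _))]
    calc _ = ∫⁻ a in Set.Ioi (0 : ℝ), ∫⁻ s in timeChamber n,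
            ∫⁻ y, heatKernelE d a (y - x) * (V y * jointMoment d V y s) := by
          rw [← lintegral_indicator measurableSet_Ioi]
          refine lintegral_congr fun a => ?_
          rw [← lintegral_add_right_eq_self _ (fun _ => a)]
          by_cases ha : 0 < a
          · rw [Set.indicator_of_mem (Set.mem_Ioi.mpr ha),
              ← lintegral_indicator (measurableSet_timeChamber n)]
            refine lintegral_congr fun s => ?_
            by_cases hs : s ∈ timeChamber n
            · rw [Set.indicator_of_mem hs,
                Set.indicator_of_mem (cons_add_mem_timeChamber.mpr ⟨ha, hs⟩),
                jointMoment_cons hV x ha]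
            · rw [Set.indicator_of_notMem hs,
                Set.indicator_of_notMem fun h => hs (cons_add_mem_timeChamber.mp h).2]
          · rw [Set.indicator_of_notMem (by simpa using ha), lintegral_eq_zero_of_ae_eq_zero]
            refine ae_of_all _ fun s => ?_
            exact Set.indicator_of_notMem (fun h => ha (cons_add_mem_timeChamber.mp h).1) _
      _ = ∫⁻ a in Set.Ioi (0 : ℝ), ∫⁻ y, heatKernelE d a (y - x) * (V y * greenIter d V n y) := by
          refine lintegral_congr fun a => ?_
          rw [lintegral_lintegral_swap (by fun_prop)]
          refine lintegral_congr fun y => ?_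
          have : Measurable fun s : Fin n → ℝ => jointMoment d V y s :=
            measurable_jointMoment hV measurable_const measurable_id
          rw [lintegral_const_mul _ (by fun_prop), lintegral_const_mul _ this, ih]
      _ = greenIter d V (n + 1) x := by
          rw [lintegral_lintegral_swap (by fun_prop)]
          refine lintegral_congr fun y => ?_
          rw [lintegral_mul_const _ (by fun_prop)]
          rfl

/-! ### Moments of the total path integral -/

section Brownian

variable {Ω : Type*} [MeasureSpace Ω] {d : ℕ} {x : Euc d} {W : ℝ → Ω → Euc d}

lemma IsBrownianMotion.aemeasurable_pi (hW : IsBrownianMotion x W) {k : ℕ}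
    {s : Fin (k + 1) → ℝ} (hs : s ∈ timeChamber (k + 1)) :
    AEMeasurable (fun ω (i : Fin (k + 1)) => W (s i) ω) (ℙ : Measure Ω) := by
  by_contra hc
  have h := hW.2.2 k s hs.1 hs.2
  rw [Measure.map_of_not_aemeasurable hc, eq_comm, withDensity_eq_zero_iff (by fun_prop)] at h
  obtain ⟨z, hz⟩ := h.exists
  exact (ENNReal.ofReal_pos.mpr (jointDensity_pos x hs z)).ne' hz

lemma IsBrownianMotion.lintegral_prod (hW : IsBrownianMotion x W)
    [IsProbabilityMeasure (ℙ : Measure Ω)] {V : Euc d → ENNReal} (hV : Measurable V) {n : ℕ}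
    {s : Fin n → ℝ} (hs : s ∈ timeChamber n) :
    ∫⁻ ω, ∏ i, V (W (s i) ω) = jointMoment d V x s := by
  cases n with
  | zero => simp [jointMoment, jointDensity, volume_pi]
  | succ k =>
    have hm : Measurable fun z : Fin (k + 1) → Euc d => ∏ i, V (z i) := by fun_prop
    have h := lintegral_map' (μ := (ℙ : Measure Ω)) hm.aemeasurable (hW.aemeasurable_pi hs)
    rw [← h, hW.2.2 k s hs.1 hs.2, lintegral_withDensity_eq_lintegral_mul _ (by fun_prop) hm]
    rfl

/-- A jointly measurable process which almost surely agrees with `W` at positive times. -/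
lemma IsBrownianMotion.exists_measurable (hW : IsBrownianMotion x W) :
    ∃ W' : ℝ → Ω → Euc d, Measurable (Function.uncurry W') ∧
      ∀ᵐ ω, ∀ s, 0 < s → W' s ω = W s ω := by
  have hae : ∀ s : ℝ, 0 < s → AEMeasurable (W s) (ℙ : Measure Ω) := by
    intro s hs
    have hmem : (fun _ : Fin (0 + 1) => s) ∈ timeChamber (0 + 1) :=
      ⟨fun i j hij => by lia, fun _ => hs⟩
    exact (measurable_pi_apply (0 : Fin 1)).comp_aemeasurable (hW.aemeasurable_pi hmem)
  have hnull : ∀ᵐ ω, ∀ q : {q : ℚ // 0 < (q : ℝ)}, W q ω = (hae q q.2).mk _ ω :=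
    ae_all_iff.mpr fun q => (hae q q.2).ae_eq_mk
  obtain ⟨N, hN, hNm, hN0⟩ := exists_measurable_superset_of_null (ae_iff.mp hnull)
  have hgood : ∀ ω ∉ N, ∀ q : {q : ℚ // 0 < (q : ℝ)}, W q ω = (hae q q.2).mk _ ω := by
    intro ω hω
    by_contra hc
    exact hω (hN hc)
  classical
  let W' : ℝ → Ω → Euc d := fun s ω => if ω ∈ N then x else W (max s 0) ω
  have hcont : ∀ ω, Continuous fun s => W' s ω := by
    intro ω
    by_cases hω : ω ∈ N
    · simp only [W', hω, if_true]; exact continuous_const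
    · simp only [W', hω, if_false]
      exact (hW.2.1 ω).comp (continuous_id.max continuous_const)
  have hrat : ∀ q : ℚ, 0 < (q : ℝ) → Measurable (W' q) := by
    intro q hq
    have : W' q = fun ω => if ω ∈ N then x else (hae q hq).mk _ ω := by
      ext1 ω
      by_cases hω : ω ∈ N
      · simp [W', hω]
      · simp only [W', hω, if_false, max_eq_left hq.le]
        exact hgood ω hω ⟨q, hq⟩
    rw [this]
    exact Measurable.ite hNm measurable_const (hae q hq).measurable_mk
  have hmeas : ∀ s, Measurable (W' s) := by
    intro s
    have hmax : W' s = W' (max s 0) := by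
      ext1 ω; simp [W']
    obtain ⟨u, -, hu, hlim⟩ := Real.exists_seq_rat_strictAnti_tendsto (max s 0)
    rw [hmax]
    refine measurable_of_tendsto_metrizable
      (fun n => hrat (u n) ((le_max_right s 0).trans_lt (hu n))) ?_
    rw [tendsto_pi_nhds]
    intro ω
    exact ((hcont ω).tendsto _).comp hlim
  refine ⟨W', measurable_uncurry_of_continuous_of_measurable hcont hmeas, ?_⟩
  have : ∀ᵐ ω, ω ∉ N := measure_eq_zero_iff_ae_notMem.mp hN0
  filter_upwards [this] with ω hω s hs
  simp only [W', hω, if_false, max_eq_left hs.le]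

/-- The total path integral as an extended nonnegative real. -/
def totalPathE {d : ℕ} (V : Euc d → ENNReal) (W : ℝ → Ω → Euc d) (ω : Ω) : ENNReal :=
  ∫⁻ s in Set.Ioi (0 : ℝ), V (W s ω)

lemma measurable_totalPathE {V : Euc d → ENNReal} (hV : Measurable V)
    (hWm : Measurable (Function.uncurry W)) : Measurable (totalPathE V W) :=
  Measurable.lintegral_prod_right' (f := fun p : Ω × ℝ => V (W p.2 p.1))
    (hV.comp (hWm.comp measurable_swap))

lemma totalPathE_ae_eq {W' : ℝ → Ω → Euc d} (V : Euc d → ENNReal)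
    (h : ∀ᵐ ω, ∀ s, 0 < s → W' s ω = W s ω) :
    totalPathE V W' =ᵐ[ℙ] totalPathE V W := by
  filter_upwards [h] with ω hω
  exact setLIntegral_congr_fun measurableSet_Ioi fun s hs => by rw [hω s hs]

/-- Kac's moment formula. -/
lemma IsBrownianMotion.lintegral_totalPathE_pow (hW : IsBrownianMotion x W)
    [IsProbabilityMeasure (ℙ : Measure Ω)] {V : Euc d → ENNReal} (hV : Measurable V) (n : ℕ) :
    ∫⁻ ω, totalPathE V W ω ^ n = n.factorial * greenIter d V n x := by
  obtain ⟨W', hWm, hWW⟩ := hW.exists_measurable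
  have hZ := totalPathE_ae_eq V hWW
  let h : Ω → ℝ → ENNReal := fun ω => (Set.Ioi (0 : ℝ)).indicator fun s => V (W' s ω)
  have hhm : Measurable (Function.uncurry h) := by
    have : Function.uncurry h = (Prod.snd ⁻¹' Set.Ioi (0 : ℝ)).indicator
        (fun p : Ω × ℝ => V (W' p.2 p.1)) := by
      ext ⟨ω, s⟩; simp [h, Set.indicator]
    rw [this]
    exact (hV.comp (hWm.comp measurable_swap)).indicator (measurable_snd measurableSet_Ioi)
  have hhm1 : ∀ ω, Measurable (h ω) := fun ω => hhm.comp measurable_prodMk_left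
  have hhp : Measurable fun p : Ω × (Fin n → ℝ) => ∏ i, h p.1 (p.2 i) :=
    Finset.measurable_prod _ fun i _ =>
      hhm.comp (measurable_fst.prodMk ((measurable_pi_apply i).comp measurable_snd))
  calc ∫⁻ ω, totalPathE V W ω ^ n = ∫⁻ ω, (∫⁻ s, h ω s) ^ n := by
        refine lintegral_congr_ae ?_
        filter_upwards [hZ] with ω hω
        rw [← hω, totalPathE, ← lintegral_indicator measurableSet_Ioi]
    _ = ∫⁻ ω, n.factorial * ∫⁻ s in {s : Fin n → ℝ | StrictMono s}, ∏ i, h ω (s i) := by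
        refine lintegral_congr fun ω => ?_
        rw [← lintegral_prod_eq_pow (hhm1 ω), lintegral_eq_factorial_mul_strictMono]
        intro σ s
        exact Equiv.prod_comp σ fun i => h ω (s i)
    _ = n.factorial * ∫⁻ s in {s : Fin n → ℝ | StrictMono s}, ∫⁻ ω, ∏ i, h ω (s i) := by
        rw [lintegral_const_mul _ hhp.lintegral_prod_right', lintegral_lintegral_swap]
        exact hhp.aemeasurable
    _ = n.factorial * ∫⁻ s in timeChamber n, jointMoment d V x s := by
        congr 1
        rw [← lintegral_indicator (measurableSet_timeChamber n),
          ← lintegral_indicator (measurableSet_strictMono_fin n)]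
        refine lintegral_congr fun s => ?_
        by_cases hm : StrictMono s
        · rw [Set.indicator_of_mem (by exact hm)]
          by_cases hp : ∀ i, 0 < s i
          · rw [Set.indicator_of_mem (by exact ⟨hm, hp⟩), ← hW.lintegral_prod hV ⟨hm, hp⟩]
            refine lintegral_congr_ae ?_
            filter_upwards [hWW] with ω hω
            refine Finset.prod_congr rfl fun i _ => ?_
            simp only [h]
            rw [Set.indicator_of_mem (Set.mem_Ioi.mpr (hp i)), hω _ (hp i)]
          · rw [Set.indicator_of_notMem fun hc => hp hc.2]
            push Not at hp
            obtain ⟨i, hi⟩ := hp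
            refine lintegral_eq_zero_of_ae_eq_zero (ae_of_all _ fun ω => ?_)
            refine Finset.prod_eq_zero (Finset.mem_univ i) ?_
            exact Set.indicator_of_notMem (not_lt.mpr hi) _
        · rw [Set.indicator_of_notMem (by exact hm), Set.indicator_of_notMem fun hc => hm hc.1]
    _ = n.factorial * greenIter d V n x := by
        rw [setLIntegral_timeChamber_jointMoment hV]

lemma ofReal_exp_mul_toReal {α : ℝ} (hα : 0 ≤ α) {Z : ENNReal} (hZ : Z ≠ ⊤) :
    ENNReal.ofReal (Real.exp (α * Z.toReal)) =
      ∑' n : ℕ, ENNReal.ofReal α ^ n * ((n.factorial : ENNReal)⁻¹ * Z ^ n) := by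
  rw [Real.exp_eq_exp_ℝ, NormedSpace.exp_eq_tsum_div]
  have h0 : 0 ≤ α * Z.toReal := by positivity
  rw [ENNReal.ofReal_tsum_of_nonneg (fun n => by positivity)
    (Real.summable_pow_div_factorial _)]
  refine tsum_congr fun n => ?_
  rw [ENNReal.ofReal_div_of_pos (by positivity), ENNReal.ofReal_pow h0, ENNReal.ofReal_mul hα,
    ENNReal.ofReal_toReal hZ, ENNReal.ofReal_natCast, mul_pow, div_eq_mul_inv]
  ring

/-- The exponential moment of the total path integral is the Green series. -/
lemma IsBrownianMotion.lintegral_exp_pathIntInf (hW : IsBrownianMotion x W)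
    [IsProbabilityMeasure (ℙ : Measure Ω)] {v : Euc d → ℝ} (hv : Measurable v)
    (hv0 : ∀ z, 0 ≤ v z) (hfin : greenIter d (fun z => ENNReal.ofReal (v z)) 1 x ≠ ⊤)
    {α : ℝ} (hα : 0 ≤ α) :
    ∫⁻ ω, ENNReal.ofReal (Real.exp (α * pathIntInf v W ω)) =
      ∑' n, ENNReal.ofReal α ^ n * greenIter d (fun z => ENNReal.ofReal (v z)) n x := by
  set V : Euc d → ENNReal := fun z => ENNReal.ofReal (v z) with hVdef
  have hV : Measurable V := hv.ennreal_ofReal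
  obtain ⟨W', hWm, hWW⟩ := hW.exists_measurable
  have hZ := totalPathE_ae_eq V hWW
  have hZm : AEMeasurable (totalPathE V W) (ℙ : Measure Ω) :=
    ⟨_, measurable_totalPathE hV hWm, hZ.symm⟩
  have htop : ∀ᵐ ω, totalPathE V W ω < ⊤ := by
    refine ae_lt_top' hZm ?_
    have := hW.lintegral_totalPathE_pow hV 1
    simp only [pow_one, Nat.factorial_one, Nat.cast_one, one_mul] at this
    rwa [this]
  have hY : ∀ ω, pathIntInf v W ω = (totalPathE V W ω).toReal := by
    intro ω
    exact integral_eq_lintegral_of_nonneg_ae (ae_of_all _ fun s => hv0 _)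
      (hv.comp (hW.2.1 ω).measurable).aestronglyMeasurable
  calc _ = ∫⁻ ω, ∑' n : ℕ, ENNReal.ofReal α ^ n *
          ((n.factorial : ENNReal)⁻¹ * totalPathE V W ω ^ n) := by
        refine lintegral_congr_ae ?_
        filter_upwards [htop] with ω hω
        rw [hY, ofReal_exp_mul_toReal hα hω.ne]
    _ = _ := by
        rw [lintegral_tsum fun n => by fun_prop]
        refine tsum_congr fun n => ?_
        rw [lintegral_const_mul'' _ (by fun_prop), lintegral_const_mul'' _ (by fun_prop),
          hW.lintegral_totalPathE_pow hV, ← mul_assoc (_ : ENNReal)⁻¹,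
          ENNReal.inv_mul_cancel (by positivity) (ENNReal.natCast_ne_top _), one_mul]

end Brownian

/-- Lemma 3: existence of a finite critical exponent `α₁` for a nonnegative potential. -/
theorem stmt6 (d : ℕ) (hd : 3 ≤ d) (v : Euc d → ℝ)
    (hvm : Measurable v) (hvb : ∃ C : ℝ, ∀ z, |v z| ≤ C)
    (hvs : ∃ R : ℝ, ∀ z, v z ≠ 0 → ‖z‖ ≤ R)
    (hv0 : ∀ z, 0 ≤ v z) (hvne : ¬ (v =ᵐ[(volume : Measure (Euc d))] 0))
    {Ω : Type*} [MeasureSpace Ω] [IsProbabilityMeasure (ℙ : Measure Ω)]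
    (W : Euc d → ℝ → Ω → Euc d) (hW : ∀ x, IsBrownianMotion x (W x)) :
    ∃ α₁ : ℝ, 0 < α₁ ∧
      (∀ α : ℝ, α < α₁ → ∀ x : Euc d,
        (∫⁻ ω, ENNReal.ofReal (Real.exp (α * pathIntInf v (W x) ω))) ≠ ⊤) ∧
      (∀ α : ℝ, α₁ < α → ∀ x : Euc d,
        (∫⁻ ω, ENNReal.ofReal (Real.exp (α * pathIntInf v (W x) ω))) = ⊤) := by
  obtain ⟨C, hC⟩ := hvb
  obtain ⟨R, hR⟩ := hvs
  set V : Euc d → ENNReal := fun z => ENNReal.ofReal (v z) with hVdef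
  have hV : Measurable V := hvm.ennreal_ofReal
  have hVC : ∀ z, V z ≤ ENNReal.ofReal C := fun z =>
    ENNReal.ofReal_le_ofReal ((le_abs_self _).trans (hC z))
  have hVR : ∀ z, V z ≠ 0 → ‖z‖ ≤ max R 0 := fun z hz =>
    (hR z fun h => hz (by simp [hVdef, h])).trans (le_max_left _ _)
  have hVne : ∫⁻ y, V y ≠ 0 := by
    intro h
    rw [lintegral_eq_zero_iff hV] at h
    refine hvne ?_
    filter_upwards [h] with z hz
    exact le_antisymm (ENNReal.ofReal_eq_zero.mp hz) (hv0 z)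
  have hVi : ∫⁻ y, V y ≠ ⊤ := by
    have hle : ∫⁻ y, V y ≤ ∫⁻ _ in Metric.closedBall (0 : Euc d) (max R 0), ENNReal.ofReal C := by
      rw [← lintegral_indicator measurableSet_closedBall]
      refine lintegral_mono fun y => ?_
      by_cases hy : V y = 0
      · simp [hy]
      · rw [Set.indicator_of_mem (by simpa using hVR y hy)]
        exact hVC y
    refine ne_top_of_le_ne_top ?_ hle
    rw [setLIntegral_const]
    exact ENNReal.mul_ne_top ENNReal.ofReal_ne_top measure_closedBall_lt_top.ne
  obtain ⟨K, hK, hKle⟩ := exists_greenIter_le_pow hd hV hVC ENNReal.ofReal_ne_top hVi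
  obtain ⟨c, hc, hcle⟩ := exists_pow_le_greenIter hV hVR hVne
  have hexp : ∀ α : ℝ, 0 ≤ α → ∀ x,
      ∫⁻ ω, ENNReal.ofReal (Real.exp (α * pathIntInf v (W x) ω)) =
        ∑' n, ENNReal.ofReal α ^ n * greenIter d V n x := fun α hα x =>
    (hW x).lintegral_exp_pathIntInf hvm hv0
      (ne_top_of_le_ne_top (by simpa using hK) (hKle 1 x)) hα
  have hmono : ∀ α β : ℝ, α ≤ β → ∀ x,
      ∫⁻ ω, ENNReal.ofReal (Real.exp (α * pathIntInf v (W x) ω)) ≤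
        ∫⁻ ω, ENNReal.ofReal (Real.exp (β * pathIntInf v (W x) ω)) := by
    intro α β hαβ x
    refine lintegral_mono fun ω => ?_
    have : 0 ≤ pathIntInf v (W x) ω := integral_nonneg fun s => hv0 _
    dsimp only
    gcongr
  set A : Set ℝ := {α | 0 ≤ α ∧ ∑' n, ENNReal.ofReal α ^ n * greenIter d V n 0 ≠ ⊤} with hA
  have hsmall : ∃ α ∈ A, 0 < α := by
    refine ⟨1 / (2 * (K.toReal + 1)), ⟨by positivity, ?_⟩, by positivity⟩
    have hr : ENNReal.ofReal (1 / (2 * (K.toReal + 1))) * K ≤ 2⁻¹ := by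
      have h0 : 0 ≤ K.toReal := ENNReal.toReal_nonneg
      conv_lhs => rw [← ENNReal.ofReal_toReal hK]
      rw [ENNReal.toReal_ofReal h0, ← ENNReal.ofReal_mul (by positivity),
        show (2⁻¹ : ENNReal) = ENNReal.ofReal 2⁻¹ by simp]
      refine ENNReal.ofReal_le_ofReal ?_
      rw [one_div, inv_mul_le_iff₀ (by positivity)]
      linarith
    refine ne_top_of_le_ne_top (b := ∑' n : ℕ, (2⁻¹ : ENNReal) ^ n) ?_
      (ENNReal.tsum_le_tsum fun n => ?_)
    · rw [ENNReal.tsum_geometric, ENNReal.one_sub_inv_two, inv_inv]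
      exact ENNReal.ofNat_ne_top
    · calc _ ≤ ENNReal.ofReal (1 / (2 * (K.toReal + 1))) ^ n * K ^ n := by
            gcongr; exact hKle n 0
        _ ≤ _ := by rw [← mul_pow]; gcongr
  have hbdd : BddAbove A := by
    have hc' : c ≠ ⊤ := by
      have := hcle 1 0 (by simp)
      exact ne_top_of_le_ne_top (ne_top_of_le_ne_top (by simpa using hK) (hKle 1 0))
        (by simpa using this)
    refine ⟨(c⁻¹).toReal, fun α hα => ?_⟩
    by_contra! hlt
    refine hα.2 (top_le_iff.mp ?_)
    have h1 : 1 ≤ ENNReal.ofReal α * c := by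
      rw [← ENNReal.inv_mul_cancel hc hc']
      gcongr
      exact ENNReal.le_ofReal_iff_toReal_le (ENNReal.inv_ne_top.mpr hc) hα.1 |>.mpr hlt.le
    calc (⊤ : ENNReal) = ∑' _ : ℕ, 1 := (ENNReal.tsum_const_eq_top_of_ne_zero one_ne_zero).symm
      _ ≤ _ := ENNReal.tsum_le_tsum fun n => by
          calc (1 : ENNReal) ≤ (ENNReal.ofReal α * c) ^ n := one_le_pow₀ h1
            _ ≤ _ := by rw [mul_pow]; gcongr; exact hcle n 0 (by simp)
  obtain ⟨α₀, hα₀, hα₀pos⟩ := hsmall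
  refine ⟨sSup A, hα₀pos.trans_le (le_csSup hbdd hα₀), fun α hα x => ?_, fun α hα x => ?_⟩
  · obtain ⟨β, hβ, hαβ⟩ := exists_lt_of_lt_csSup ⟨α₀, hα₀⟩ hα
    refine ne_top_of_le_ne_top ?_ (hmono α β hαβ.le x)
    rw [hexp β hβ.1]
    exact tsum_greenIter_ne_top hd hV hVC ENNReal.ofReal_ne_top hVR ENNReal.ofReal_ne_top hβ.2 x
  · by_contra hfin
    have hα0 : 0 ≤ α := (hα₀pos.le.trans (le_csSup hbdd hα₀)).trans hα.le
    rw [hexp α hα0] at hfin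
    refine hα.not_ge (le_csSup hbdd ⟨hα0, ?_⟩)
    exact tsum_greenIter_ne_top hd hV hVC ENNReal.ofReal_ne_top hVR ENNReal.ofReal_ne_top hfin 0

end
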